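/- Let C_hv ∈ ℝ and C_d ≥ 0. Define k_Γ : ℕ₊ × ℕ₊ → ℝ by k_Γ(i,j) = ∑_{d=0}^{min(i,j)−1} C_hv^{i+j−2−2d} · C_d^d · (i+j−2−d)! / ((i−1−d)! (j−1−d)! d!). Then k_Γ is a positive semidefinite kernel on the positive integers. -/

import Mathlib

def IsPSDKernel {X : Type*} (k : X → X → ℝ) : Prop :=
  ∀ (n : ℕ) (x : Fin n → X) (c : Fin n → ℝ),
    0 ≤ ∑ i : Fin n, ∑ j : Fin n, c i * c j * k (x i) (x j)

/-- The structure kernel `k_Γ` of the Path kernel (Eq. 5). -/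
noncomputable def kGamma (Chv Cd : ℝ) (i j : ℕ) : ℝ :=
  ∑ d ∈ Finset.range (min i j),
    Chv ^ (i + j - 2 - 2 * d) * Cd ^ d *
      ((Nat.factorial (i + j - 2 - d) : ℝ) /
        ((Nat.factorial (i - 1 - d) : ℝ) * (Nat.factorial (j - 1 - d) : ℝ) *
          (Nat.factorial d : ℝ)))

theorem choose_sum_aux (a b d N : ℕ) (hN : a < N) (hd : d ≤ a) :
    ∑ m ∈ Finset.range N, a.choose m * b.choose m * m.choose d
      = a.choose d * (a + b - d).choose a := by
  have h1 : ∑ m ∈ Finset.range N, a.choose m * b.choose m * m.choose d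
      = ∑ m ∈ Finset.range (a + 1), a.choose m * b.choose m * m.choose d := by
    symm
    apply Finset.sum_subset
    · intro m hm
      simp only [Finset.mem_range] at *
      omega
    · intro m _ hm
      simp only [Finset.mem_range, not_lt] at hm
      rw [Nat.choose_eq_zero_of_lt (by omega : a < m)]
      simp
  have h2 : a + b - d = b + (a - d) := by omega
  rw [h1, h2, Nat.add_choose_eq, Finset.Nat.sum_antidiagonal_eq_sum_range_succ_mk,
    Finset.mul_sum]
  apply Finset.sum_congr rfl
  intro m hm
  have hm' : m ≤ a := by
    simp only [Finset.mem_range] at hm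
    omega
  by_cases hdm : d ≤ m
  · have h3 := Nat.choose_mul (n := a) hdm
    have h4 : (a - d).choose (a - m) = (a - d).choose (m - d) := by
      rw [← Nat.choose_symm (by omega : m - d ≤ a - d)]
      congr 1
      omega
    simp only [h4]
    calc a.choose m * b.choose m * m.choose d
        = (a.choose m * m.choose d) * b.choose m := by ring
      _ = _ := by rw [h3]; ring
  · simp only [Nat.choose_eq_zero_of_lt (by omega : m < d),
      Nat.choose_eq_zero_of_lt (by omega : a - d < a - m), mul_zero]

theorem kGamma_eq_aux (h C : ℝ) (a b N : ℕ) (hN : a < N) :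
    kGamma h C (a + 1) (b + 1) = ∑ m ∈ Finset.range N, (C + h ^ 2) ^ m *
      ((a.choose m * h ^ (a - m)) * (b.choose m * h ^ (b - m))) := by
  have hR : ∀ m ∈ Finset.range N, (C + h ^ 2) ^ m *
      ((a.choose m * h ^ (a - m)) * (b.choose m * h ^ (b - m)))
      = ∑ d ∈ Finset.range N, h ^ (a + b - 2 * d) * C ^ d *
        ((a.choose m * b.choose m * m.choose d : ℕ) : ℝ) := by
    intro m hm
    rw [add_pow, Finset.sum_mul]
    have hs : Finset.range (m + 1) ⊆ Finset.range N := by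
      intro x hx
      simp only [Finset.mem_range] at *
      omega
    rw [← Finset.sum_subset hs]
    · apply Finset.sum_congr rfl
      intro d hd
      simp only [Finset.mem_range] at hd
      by_cases ha : m ≤ a
      · by_cases hb : m ≤ b
        · have e : a + b - 2 * d = 2 * (m - d) + (a - m) + (b - m) := by omega
          rw [e, pow_add, pow_add, ← pow_mul]
          push_cast
          ring
        · simp [Nat.choose_eq_zero_of_lt (by omega : b < m)]
      · simp [Nat.choose_eq_zero_of_lt (by omega : a < m)]
    · intro d _ hd
      simp only [Finset.mem_range, not_lt] at hd
      simp [Nat.choose_eq_zero_of_lt (by omega : m < d)]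
  rw [Finset.sum_congr rfl hR, Finset.sum_comm]
  simp only [← Finset.mul_sum, ← Nat.cast_sum]
  unfold kGamma
  have hs : Finset.range (min (a + 1) (b + 1)) ⊆ Finset.range N := by
    intro x hx
    simp only [Finset.mem_range] at *
    omega
  rw [← Finset.sum_subset hs]
  · apply Finset.sum_congr rfl
    intro d hd
    simp only [Finset.mem_range] at hd
    have hda : d ≤ a := by omega
    have hdb : d ≤ b := by omega
    rw [choose_sum_aux a b d N hN hda]
    have e1 : a + 1 + (b + 1) - 2 - 2 * d = a + b - 2 * d := by omega
    have e2 : a + 1 + (b + 1) - 2 - d = a + b - d := by omega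
    rw [e1, e2, Nat.add_sub_cancel, Nat.add_sub_cancel]
    congr 1
    push_cast
    rw [Nat.cast_choose ℝ hda, Nat.cast_choose ℝ (by omega : a ≤ a + b - d),
      (by omega : a + b - d - a = b - d)]
    have := Nat.factorial_ne_zero a
    field_simp
  · intro d _ hd
    simp only [Finset.mem_range, not_lt] at hd
    have : ∑ m ∈ Finset.range N, a.choose m * b.choose m * m.choose d = 0 := by
      apply Finset.sum_eq_zero
      intro m _
      by_cases h1 : m < d
      · simp [Nat.choose_eq_zero_of_lt h1]
      · by_cases h2 : a < m
        · simp [Nat.choose_eq_zero_of_lt h2]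
        · simp [Nat.choose_eq_zero_of_lt (by omega : b < m)]
    rw [this]
    simp

/-- The structure kernel `k_Γ` is positive semidefinite on the positive
integers, for any `C_hv ∈ ℝ` and `C_d ≥ 0`. -/
theorem kGamma_is_psd (Chv Cd : ℝ) (hCd : 0 ≤ Cd) :
    IsPSDKernel (fun (i j : ℕ+) => kGamma Chv Cd i j) := by
  intro n x c
  obtain ⟨N, hN⟩ : ∃ N : ℕ, ∀ i, (x i : ℕ) - 1 < N := by
    refine ⟨∑ i, (x i : ℕ), fun i => ?_⟩
    have h1 := Finset.single_le_sum (f := fun i => (x i : ℕ)) (fun i _ => Nat.zero_le _)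
      (Finset.mem_univ i)
    have h2 := (x i).pos
    omega
  let f : Fin n → ℕ → ℝ := fun i m =>
    (((x i : ℕ) - 1).choose m : ℝ) * Chv ^ ((x i : ℕ) - 1 - m)
  have key : ∀ i j, kGamma Chv Cd (x i) (x j)
      = ∑ m ∈ Finset.range N, (Cd + Chv ^ 2) ^ m * (f i m * f j m) := by
    intro i j
    have := kGamma_eq_aux Chv Cd ((x i : ℕ) - 1) ((x j : ℕ) - 1) N (hN i)
    rwa [Nat.sub_add_cancel (x i).pos, Nat.sub_add_cancel (x j).pos] at this
  have : ∑ i : Fin n, ∑ j : Fin n, c i * c j * kGamma Chv Cd (x i) (x j)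
      = ∑ m ∈ Finset.range N, (Cd + Chv ^ 2) ^ m * (∑ i, c i * f i m) ^ 2 := by
    simp only [sq (∑ i, c i * f i _), Finset.sum_mul_sum]
    simp only [key, Finset.mul_sum]
    rw [Finset.sum_comm (s := Finset.range N)]
    refine Finset.sum_congr rfl fun i _ => ?_
    rw [Finset.sum_comm (s := Finset.range N)]
    refine Finset.sum_congr rfl fun j _ => Finset.sum_congr rfl fun m _ => ?_
    ring
  show 0 ≤ ∑ i : Fin n, ∑ j : Fin n, c i * c j * kGamma Chv Cd (x i) (x j)
  rw [this]
  exact Finset.sum_nonneg fun m _ => by positivity
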